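/- Strong normalization for IEL⁻ (full normalization theorem): the reduction relation on well-typed λ^{□→∧∨⊥}-terms given by the union of the detour-conversions >_D, the permutation-conversions >_P (including the clause E(C_{x,y}(t,t₁,t₂)) > C_{x,y}(t,E(t₁),E(t₂))), and the ⊥-conversions >_⊥ is strongly normalizing: there is no infinite reduction sequence t₀ > t₁ > t₂ > … starting from a well-typed term (equivalently, the converse of the reduction relation restricted to well-typed terms is well-founded). -/

import Mathlib

namespace IEL

/-- de Bruijn lifting of a renaming under `n` extra binders. -/
def liftRen (n : ℕ) (f : ℕ → ℕ) : ℕ → ℕ :=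
  fun j => if j < n then j else f (j - n) + n

/-- Terms of the calculus `λ^{□→∧∨⊥}` in de Bruijn representation.
In `box ts s`, the body `s` is under `ts.length` binders: de Bruijn index `j` in `s`
refers to the binding for `ts[ts.length - 1 - j]` (i.e. `x₁` is the outermost binder).
`exf t` is the ex falso term `E(t)`. -/
inductive Tm : Type where
  | var : ℕ → Tm
  | lam : Tm → Tm
  | app : Tm → Tm → Tm
  | pair : Tm → Tm → Tm
  | proj1 : Tm → Tm
  | proj2 : Tm → Tm
  | inl : Tm → Tm
  | inr : Tm → Tm
  | case : Tm → Tm → Tm → Tm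
  | box : List Tm → Tm → Tm
  | exf : Tm → Tm

def Tm.rename (f : ℕ → ℕ) : Tm → Tm
  | .var n => .var (f n)
  | .lam t => .lam (t.rename (liftRen 1 f))
  | .app t s => .app (t.rename f) (s.rename f)
  | .pair t s => .pair (t.rename f) (s.rename f)
  | .proj1 t => .proj1 (t.rename f)
  | .proj2 t => .proj2 (t.rename f)
  | .inl t => .inl (t.rename f)
  | .inr t => .inr (t.rename f)
  | .case t a b => .case (t.rename f) (a.rename (liftRen 1 f)) (b.rename (liftRen 1 f))
  | .box ts s => .box (ts.attach.map fun x => x.1.rename f) (s.rename (liftRen ts.length f))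
  | .exf t => .exf (t.rename f)
termination_by t => sizeOf t
decreasing_by all_goals simp_wf <;> ((try have := List.sizeOf_lt_of_mem x.2); omega)

def liftSub (n : ℕ) (σ : ℕ → Tm) : ℕ → Tm :=
  fun j => if j < n then .var j else (σ (j - n)).rename (· + n)

def Tm.subst (σ : ℕ → Tm) : Tm → Tm
  | .var n => σ n
  | .lam t => .lam (t.subst (liftSub 1 σ))
  | .app t s => .app (t.subst σ) (s.subst σ)
  | .pair t s => .pair (t.subst σ) (s.subst σ)
  | .proj1 t => .proj1 (t.subst σ)
  | .proj2 t => .proj2 (t.subst σ)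
  | .inl t => .inl (t.subst σ)
  | .inr t => .inr (t.subst σ)
  | .case t a b => .case (t.subst σ) (a.subst (liftSub 1 σ)) (b.subst (liftSub 1 σ))
  | .box ts s => .box (ts.attach.map fun x => x.1.subst σ) (s.subst (liftSub ts.length σ))
  | .exf t => .exf (t.subst σ)
termination_by t => sizeOf t
decreasing_by all_goals simp_wf <;> ((try have := List.sizeOf_lt_of_mem x.2); omega)

/-- `t.subst1 s` is `t[x₀ := s]`. -/
def Tm.subst1 (t s : Tm) : Tm :=
  t.subst (fun j => match j with | 0 => s | j+1 => .var j)

/-- Compatible (contextual) closure of a base relation `R`. -/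
inductive Compat (R : Tm → Tm → Prop) : Tm → Tm → Prop where
  | base {t s} : R t s → Compat R t s
  | lam {t t'} : Compat R t t' → Compat R (.lam t) (.lam t')
  | appL {t t' s} : Compat R t t' → Compat R (.app t s) (.app t' s)
  | appR {t s s'} : Compat R s s' → Compat R (.app t s) (.app t s')
  | pairL {t t' s} : Compat R t t' → Compat R (.pair t s) (.pair t' s)
  | pairR {t s s'} : Compat R s s' → Compat R (.pair t s) (.pair t s')
  | proj1 {t t'} : Compat R t t' → Compat R (.proj1 t) (.proj1 t')
  | proj2 {t t'} : Compat R t t' → Compat R (.proj2 t) (.proj2 t')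
  | inl {t t'} : Compat R t t' → Compat R (.inl t) (.inl t')
  | inr {t t'} : Compat R t t' → Compat R (.inr t) (.inr t')
  | case1 {t t' a b} : Compat R t t' → Compat R (.case t a b) (.case t' a b)
  | case2 {t a a' b} : Compat R a a' → Compat R (.case t a b) (.case t a' b)
  | case3 {t a b b'} : Compat R b b' → Compat R (.case t a b) (.case t a b')
  | boxArg {t t' l₁ l₂ s} : Compat R t t' →
      Compat R (.box (l₁ ++ t :: l₂) s) (.box (l₁ ++ t' :: l₂) s)
  | boxBody {ts s s'} : Compat R s s' → Compat R (.box ts s) (.box ts s')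
  | exf {t t'} : Compat R t t' → Compat R (.exf t) (.exf t')

def boxRho (i m n : ℕ) : ℕ → ℕ := fun k => if k < m then i + k else k + n - 1

def boxSigma (i m n : ℕ) (v : Tm) : ℕ → Tm :=
  fun j => if j < i then .var j else if j = i then v.rename (boxRho i m n) else .var (j + m - 1)

/-- Root detour conversions. -/
inductive DRed : Tm → Tm → Prop where
  | beta {t s} : DRed (.app (.lam t) s) (t.subst1 s)
  | projPair1 {t s} : DRed (.proj1 (.pair t s)) t
  | projPair2 {t s} : DRed (.proj2 (.pair t s)) s
  | caseInl {t a b} : DRed (.case (.inl t) a b) (a.subst1 t)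
  | caseInr {t a b} : DRed (.case (.inr t) a b) (b.subst1 t)
  | boxBox {l₁ l₂ us v r} :
      DRed (.box (l₁ ++ (.box us v) :: l₂) r)
           (.box (l₁ ++ us ++ l₂)
                 (r.subst (boxSigma l₂.length us.length (l₁.length + 1 + l₂.length) v)))
  | boxVar {t} : DRed (.box [t] (.var 0)) t

/-- Root permutation conversions (including the one for `E`). -/
inductive PRed : Tm → Tm → Prop where
  | appCase {t a b s} : PRed (.app (.case t a b) s)
      (.case t (.app a (s.rename (· + 1))) (.app b (s.rename (· + 1))))
  | proj1Case {t a b} : PRed (.proj1 (.case t a b)) (.case t (.proj1 a) (.proj1 b))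
  | proj2Case {t a b} : PRed (.proj2 (.case t a b)) (.case t (.proj2 a) (.proj2 b))
  | caseCase {t a b c d} : PRed (.case (.case t a b) c d)
      (.case t (.case a (c.rename (liftRen 1 (· + 1))) (d.rename (liftRen 1 (· + 1))))
               (.case b (c.rename (liftRen 1 (· + 1))) (d.rename (liftRen 1 (· + 1)))))
  | boxCase {l₁ l₂ t a b s} :
      PRed (.box (l₁ ++ (.case t a b) :: l₂) s)
        (.case t
          (.box ((l₁.map (Tm.rename (· + 1))) ++ a :: (l₂.map (Tm.rename (· + 1))))
                (s.rename (liftRen (l₁.length + 1 + l₂.length) (· + 1))))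
          (.box ((l₁.map (Tm.rename (· + 1))) ++ b :: (l₂.map (Tm.rename (· + 1))))
                (s.rename (liftRen (l₁.length + 1 + l₂.length) (· + 1)))))
  | exfCase {t a b} : PRed (.exf (.case t a b)) (.case t (.exf a) (.exf b))

/-- Root `⊥`-conversions. -/
inductive BRed : Tm → Tm → Prop where
  | appExf {t s} : BRed (.app (.exf t) s) (.exf t)
  | proj1Exf {t} : BRed (.proj1 (.exf t)) (.exf t)
  | proj2Exf {t} : BRed (.proj2 (.exf t)) (.exf t)
  | caseExf {t a b} : BRed (.case (.exf t) a b) (.exf t)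
  | exfExf {t} : BRed (.exf (.exf t)) (.exf t)
  | boxExf {l₁ l₂ t s} : BRed (.box (l₁ ++ (.exf t) :: l₂) s) (.exf t)

/-- One-step detour reduction `>_D`. -/
def StepD : Tm → Tm → Prop := Compat DRed

/-- One-step permutation reduction `>_P`. -/
def StepP : Tm → Tm → Prop := Compat PRed

/-- One-step `⊥`-reduction `>_⊥`. -/
def StepBot : Tm → Tm → Prop := Compat BRed

/-- The full reduction relation: union of `>_D`, `>_P` and `>_⊥`. -/
def Step : Tm → Tm → Prop := fun t s => StepD t s ∨ StepP t s ∨ StepBot t s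

/-- Types: atoms, `⊥`, `→`, `×`, `+`, `□`. -/
inductive Ty : Type where
  | atom : ℕ → Ty
  | bot : Ty
  | arr : Ty → Ty → Ty
  | prod : Ty → Ty → Ty
  | sum : Ty → Ty → Ty
  | box : Ty → Ty

/-- Typing judgment `Γ ⊢ t : A` (contexts are lists, position = de Bruijn index). -/
inductive Typing : List Ty → Tm → Ty → Prop where
  | var {Γ n A} : Γ[n]? = some A → Typing Γ (.var n) A
  | lam {Γ t A B} : Typing (A :: Γ) t B → Typing Γ (.lam t) (.arr A B)
  | app {Γ t s A B} : Typing Γ t (.arr A B) → Typing Γ s A → Typing Γ (.app t s) B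
  | pair {Γ t s A B} : Typing Γ t A → Typing Γ s B → Typing Γ (.pair t s) (.prod A B)
  | proj1 {Γ t A B} : Typing Γ t (.prod A B) → Typing Γ (.proj1 t) A
  | proj2 {Γ t A B} : Typing Γ t (.prod A B) → Typing Γ (.proj2 t) B
  | inl {Γ t A B} : Typing Γ t A → Typing Γ (.inl t) (.sum A B)
  | inr {Γ t A B} : Typing Γ t B → Typing Γ (.inr t) (.sum A B)
  | case {Γ t a b A B C} : Typing Γ t (.sum A B) →
      Typing (A :: Γ) a C → Typing (B :: Γ) b C → Typing Γ (.case t a b) C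
  | box {Γ ts s As B} : ts.length = As.length →
      (∀ p ∈ List.zip ts As, Typing Γ p.1 (.box p.2)) →
      Typing (As.reverse ++ Γ) s B →
      Typing Γ (.box ts s) (.box B)
  | exf {Γ t A} : Typing Γ t .bot → Typing Γ (.exf t) A


set_option linter.unusedSimpArgs false

/-! ### Basic substitution theory -/

@[simp] theorem rename_var (f n) : (Tm.var n).rename f = .var (f n) := by simp [Tm.rename]
@[simp] theorem rename_lam (f t) : (Tm.lam t).rename f = .lam (t.rename (liftRen 1 f)) := by
  simp [Tm.rename]
@[simp] theorem rename_app (f t s) : (Tm.app t s).rename f = .app (t.rename f) (s.rename f) := by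
  simp [Tm.rename]
@[simp] theorem rename_pair (f t s) :
    (Tm.pair t s).rename f = .pair (t.rename f) (s.rename f) := by
  simp [Tm.rename]
@[simp] theorem rename_proj1 (f t) : (Tm.proj1 t).rename f = .proj1 (t.rename f) := by
  simp [Tm.rename]
@[simp] theorem rename_proj2 (f t) : (Tm.proj2 t).rename f = .proj2 (t.rename f) := by
  simp [Tm.rename]
@[simp] theorem rename_inl (f t) : (Tm.inl t).rename f = .inl (t.rename f) := by simp [Tm.rename]
@[simp] theorem rename_inr (f t) : (Tm.inr t).rename f = .inr (t.rename f) := by simp [Tm.rename]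
@[simp] theorem rename_exf (f t) : (Tm.exf t).rename f = .exf (t.rename f) := by simp [Tm.rename]
@[simp] theorem rename_case (f t a b) : (Tm.case t a b).rename f =
    .case (t.rename f) (a.rename (liftRen 1 f)) (b.rename (liftRen 1 f)) := by simp [Tm.rename]
@[simp] theorem rename_box (f ts s) : (Tm.box ts s).rename f =
    .box (ts.map (Tm.rename f)) (s.rename (liftRen ts.length f)) := by
  simp [Tm.rename, List.attach_map_val (f := Tm.rename f)]

@[simp] theorem subst_var (f n) : (Tm.var n).subst f = f n := by simp [Tm.subst]
@[simp] theorem subst_lam (f t) : (Tm.lam t).subst f = .lam (t.subst (liftSub 1 f)) := by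
  simp [Tm.subst]
@[simp] theorem subst_app (f t s) : (Tm.app t s).subst f = .app (t.subst f) (s.subst f) := by
  simp [Tm.subst]
@[simp] theorem subst_pair (f t s) :
    (Tm.pair t s).subst f = .pair (t.subst f) (s.subst f) := by
  simp [Tm.subst]
@[simp] theorem subst_proj1 (f t) : (Tm.proj1 t).subst f = .proj1 (t.subst f) := by
  simp [Tm.subst]
@[simp] theorem subst_proj2 (f t) : (Tm.proj2 t).subst f = .proj2 (t.subst f) := by
  simp [Tm.subst]
@[simp] theorem subst_inl (f t) : (Tm.inl t).subst f = .inl (t.subst f) := by simp [Tm.subst]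
@[simp] theorem subst_inr (f t) : (Tm.inr t).subst f = .inr (t.subst f) := by simp [Tm.subst]
@[simp] theorem subst_exf (f t) : (Tm.exf t).subst f = .exf (t.subst f) := by simp [Tm.subst]
@[simp] theorem subst_case (f t a b) : (Tm.case t a b).subst f =
    .case (t.subst f) (a.subst (liftSub 1 f)) (b.subst (liftSub 1 f)) := by simp [Tm.subst]
@[simp] theorem subst_box (f ts s) : (Tm.box ts s).subst f =
    .box (ts.map (Tm.subst f)) (s.subst (liftSub ts.length f)) := by
  simp [Tm.subst, List.attach_map_val (f := Tm.subst f)]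

theorem Tm.ind {P : Tm → Prop} (var : ∀ n, P (.var n)) (lam : ∀ t, P t → P (.lam t))
    (app : ∀ t s, P t → P s → P (.app t s)) (pair : ∀ t s, P t → P s → P (.pair t s))
    (proj1 : ∀ t, P t → P (.proj1 t)) (proj2 : ∀ t, P t → P (.proj2 t))
    (inl : ∀ t, P t → P (.inl t)) (inr : ∀ t, P t → P (.inr t))
    (case : ∀ t a b, P t → P a → P b → P (.case t a b))
    (box : ∀ ts s, (∀ t ∈ ts, P t) → P s → P (.box ts s))
    (exf : ∀ t, P t → P (.exf t)) (t : Tm) : P t := by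
  refine Tm.rec (motive_1 := P) (motive_2 := fun ts => ∀ t ∈ ts, P t)
    var lam app pair proj1 proj2 inl inr case box exf ?_ ?_ t
  · simp
  · intro h tl h1 h2; simpa using ⟨h1, h2⟩

theorem liftRen_comp (n f g) : liftRen n f ∘ liftRen n g = liftRen n (f ∘ g) := by
  funext j; simp only [liftRen, Function.comp]; split_ifs <;> simp_all

theorem rename_rename (t : Tm) : ∀ f g, (t.rename g).rename f = t.rename (f ∘ g) := by
  induction t using Tm.ind <;> intro f g <;> simp_all [liftRen_comp]

theorem liftSub_liftRen (n σ g) : liftSub n σ ∘ liftRen n g = liftSub n (σ ∘ g) := by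
  funext j; simp only [liftRen, liftSub, Function.comp]; split_ifs <;> simp_all

theorem subst_rename (t : Tm) : ∀ σ g, (t.rename g).subst σ = t.subst (σ ∘ g) := by
  induction t using Tm.ind <;> intro f g <;> simp_all [liftSub_liftRen]

theorem liftRen_liftSub (n f σ) :
    Tm.rename (liftRen n f) ∘ liftSub n σ = liftSub n (Tm.rename f ∘ σ) := by
  funext j; simp only [liftSub, Function.comp]; split_ifs with h
  · simp [liftRen, h]
  · simp only [rename_rename]; congr 1; funext k; simp [liftRen]

theorem rename_subst (t : Tm) : ∀ f σ, (t.subst σ).rename f = t.subst (Tm.rename f ∘ σ) := by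
  induction t using Tm.ind <;> intro f g <;> simp_all [liftRen_liftSub]

theorem liftSub_comp (n σ τ) :
    Tm.subst (liftSub n σ) ∘ liftSub n τ = liftSub n (Tm.subst σ ∘ τ) := by
  funext j; simp only [liftSub, Function.comp]; split_ifs with h
  · simp [liftSub, h]
  · simp only [subst_rename, rename_subst]; congr 1; funext k; simp [liftSub]

theorem subst_subst (t : Tm) : ∀ σ τ, (t.subst τ).subst σ = t.subst (Tm.subst σ ∘ τ) := by
  induction t using Tm.ind <;> intro f g <;> simp_all [liftSub_comp]

@[simp] theorem liftSub_var (n) : liftSub n Tm.var = Tm.var := by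
  funext j; simp only [liftSub]; split_ifs
  · rfl
  · simp; omega

theorem subst_id (t : Tm) : t.subst Tm.var = t := by
  induction t using Tm.ind <;> simp_all
  rename_i h _
  exact (List.map_congr_left h).trans (List.map_id _)

theorem liftSub_ren (n f) : liftSub n (Tm.var ∘ f) = Tm.var ∘ liftRen n f := by
  funext j; simp only [liftSub, liftRen, Function.comp]; split_ifs <;> simp

theorem rename_eq_subst (t : Tm) : ∀ f, t.rename f = t.subst (Tm.var ∘ f) := by
  induction t using Tm.ind <;> intro f <;> simp_all [liftSub_ren]

theorem rename_id (t : Tm) : t.rename id = t := by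
  rw [rename_eq_subst]; exact subst_id t

/-- Simultaneous substitution for the innermost `vs.length` variables, with a renaming `f` for
the remaining ones. -/
def msub (vs : List Tm) (f : ℕ → ℕ) : ℕ → Tm :=
  fun j => if h : j < vs.length then vs.reverse[j]'(by simpa using h) else .var (f (j - vs.length))

theorem msub_lt {vs : List Tm} {f j} (h : j < vs.length) :
    msub vs f j = vs.reverse[j]'(by simpa using h) := by simp [msub, h]
theorem msub_ge {vs : List Tm} {f j} (h : vs.length ≤ j) :
    msub vs f j = .var (f (j - vs.length)) := by simp [msub, h]

theorem subst1_eq (t s : Tm) : t.subst1 s = t.subst (msub [s] id) := by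
  unfold Tm.subst1; congr 1; funext j; cases j <;> simp [msub]

theorem rename_lift_msub (t : Tm) (n) (vs : List Tm) (f g) (h : vs.length = n) :
    (t.rename (liftRen n g)).subst (msub vs f) = t.subst (msub vs (f ∘ g)) := by
  subst h
  rw [subst_rename]; congr 1; funext j
  simp only [Function.comp, liftRen]
  split_ifs with hj
  · simp [msub, hj]
  · simp [msub, hj]

/-- general substitution with a prefix -/
def gsub (vs : List Tm) (σ : ℕ → Tm) : ℕ → Tm :=
  fun j => if h : j < vs.length then vs.reverse[j]'(by simpa using h) else σ (j - vs.length)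

theorem subst_lift_msub (t : Tm) (n) (vs : List Tm) (f σ) (h : vs.length = n) :
    (t.subst (liftSub n σ)).subst (msub vs f) = t.subst (gsub vs (Tm.rename f ∘ σ)) := by
  subst h
  rw [subst_subst]; congr 1; funext j
  simp only [Function.comp, liftSub, gsub]
  split_ifs with hj
  · simp [msub, hj]
  · rw [subst_rename, rename_eq_subst]; congr 1; funext k; simp [msub]

theorem subst_gsub_subst (t : Tm) (vs σ) (τ : ℕ → Tm) :
    (t.subst (gsub vs τ)).subst σ = t.subst (gsub (vs.map (Tm.subst σ)) (Tm.subst σ ∘ τ)) := by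
  rw [subst_subst]; congr 1; funext j
  simp only [Function.comp, gsub, List.length_map]
  split_ifs <;> simp

theorem subst_subst1 (t s : Tm) (σ) :
    (t.subst1 s).subst σ = (t.subst (liftSub 1 σ)).subst1 (s.subst σ) := by
  rw [subst1_eq, subst1_eq, subst_lift_msub _ _ _ _ _ (by simp), subst_subst]
  congr 1; funext j
  cases j <;> simp [msub, gsub]
  exact (rename_id _).symm

theorem rename_subst1 (t s : Tm) (f) :
    (t.subst1 s).rename f = (t.rename (liftRen 1 f)).subst1 (s.rename f) := by
  simp only [rename_eq_subst, subst_subst1, liftSub_ren]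

theorem subst_boxSigma (r v : Tm) (i m n : ℕ) (h : i < n) (σ) :
    (r.subst (boxSigma i m n v)).subst (liftSub (n - 1 + m) σ) =
    (r.subst (liftSub n σ)).subst (boxSigma i m n (v.subst (liftSub m σ))) := by
  rw [subst_subst, subst_subst]; congr 1; funext j
  simp only [Function.comp]
  rcases lt_trichotomy j i with hj | hj | hj
  · have h1 : j < n - 1 + m := by omega
    have h2 : j < n := by omega
    simp [boxSigma, liftSub, hj, h1, h2]
  · subst hj
    simp only [boxSigma, lt_irrefl, if_false, if_true, liftSub, h, subst_var]
    rw [subst_rename, rename_subst]; congr 1; funext k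
    simp only [Function.comp, boxRho, liftSub]
    by_cases hk : k < m
    · have h1 : j + k < n - 1 + m := by omega
      simp [hk, h1, boxRho]
    · have h1 : ¬ k + n - 1 < n - 1 + m := by omega
      have h2 : k + n - 1 - (n - 1 + m) = k - m := by omega
      simp only [hk, h1, if_false, h2, rename_rename]
      congr 1; funext x
      have : ¬ x + m < m := by omega
      simp [boxRho]; omega
  · have h0 : ¬ j < i := by omega
    have h0' : ¬ j = i := by omega
    simp only [boxSigma, h0, h0', if_false, liftSub, subst_var]
    by_cases hn : j < n
    · have h1 : j + m - 1 < n - 1 + m := by omega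
      simp [boxSigma, h1, hn, h0, h0']
    · have h1 : ¬ j + m - 1 < n - 1 + m := by omega
      have h2 : j + m - 1 - (n - 1 + m) = j - n := by omega
      simp only [h1, hn, if_false, h2, subst_rename]
      rw [rename_eq_subst]; congr 1; funext x
      have h3 : ¬ x + n < i := by omega
      have h4 : ¬ x + n = i := by omega
      simp [boxSigma, h3, h4]; omega

theorem rename_boxSigma (r v : Tm) (i m n : ℕ) (h : i < n) (f) :
    (r.subst (boxSigma i m n v)).rename (liftRen (n - 1 + m) f) =
    (r.rename (liftRen n f)).subst (boxSigma i m n (v.rename (liftRen m f))) := by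
  have := subst_boxSigma r v i m n h (Tm.var ∘ f)
  simpa only [rename_eq_subst, liftSub_ren] using this

theorem boxSigma_msub (r v : Tm) (v1 w v2 : List Tm) (f) :
    (r.subst (boxSigma v2.length w.length (v1.length + 1 + v2.length) v)).subst
      (msub (v1 ++ w ++ v2) f) = r.subst (msub (v1 ++ v.subst (msub w f) :: v2) f) := by
  rw [subst_subst]; congr 1; funext j
  simp only [Function.comp]
  rcases lt_trichotomy j v2.length with hj | hj | hj
  · simp only [boxSigma, hj, if_true, subst_var]
    rw [msub_lt (by simp; omega), msub_lt (by simp; omega)]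
    simp [List.getElem_append, hj]
  · subst hj
    simp only [boxSigma, lt_irrefl, if_false, if_true]
    rw [msub_lt (by simp; omega), subst_rename]
    simp only [List.reverse_append, List.reverse_cons, List.append_assoc]
    rw [List.getElem_append_right (by simp)]
    simp only [List.length_reverse, Nat.sub_self, List.cons_append, List.nil_append,
      List.getElem_cons_zero]
    congr 1; funext k
    simp only [Function.comp, boxRho]
    by_cases hk : k < w.length
    · simp only [hk, if_true]
      rw [msub_lt (by simp; omega), msub_lt hk]
      simp [List.getElem_append, hk]
    · simp only [hk, if_false]
      rw [msub_ge (by simp; omega), msub_ge (by omega)]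
      congr 2; simp; omega
  · have h0 : ¬ j < v2.length := by omega
    have h0' : ¬ j = v2.length := by omega
    simp only [boxSigma, h0, h0', if_false, subst_var]
    by_cases hn : j < v1.length + 1 + v2.length
    · rw [msub_lt (by simp; omega), msub_lt (by simp; omega)]
      simp only [List.reverse_append, List.reverse_cons, List.append_assoc]
      rw [List.getElem_append_right (by simp; omega), List.getElem_append_right (by simp; omega),
        List.getElem_append_right (by simp; omega), List.getElem_append_right (by simp; omega)]
      congr 1; simp; omega
    · rw [msub_ge (by simp; omega), msub_ge (by simp; omega)]
      congr 2; simp; omega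


set_option linter.unusedSimpArgs false

/-! ### Reduction versus substitution and renaming -/

def Root (t s : Tm) : Prop := DRed t s ∨ PRed t s ∨ BRed t s

theorem Compat.mono {R R' : Tm → Tm → Prop} (h : ∀ t s, R t s → R' t s) {t s}
    (H : Compat R t s) : Compat R' t s := by
  induction H with
  | base h' => exact .base (h _ _ h')
  | lam _ ih => exact .lam ih
  | appL _ ih => exact .appL ih
  | appR _ ih => exact .appR ih
  | pairL _ ih => exact .pairL ih
  | pairR _ ih => exact .pairR ih
  | proj1 _ ih => exact .proj1 ih
  | proj2 _ ih => exact .proj2 ih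
  | inl _ ih => exact .inl ih
  | inr _ ih => exact .inr ih
  | case1 _ ih => exact .case1 ih
  | case2 _ ih => exact .case2 ih
  | case3 _ ih => exact .case3 ih
  | boxArg _ ih => exact .boxArg ih
  | boxBody _ ih => exact .boxBody ih
  | exf _ ih => exact .exf ih

theorem Compat.or {R R' : Tm → Tm → Prop} {t s}
    (H : Compat (fun a b => R a b ∨ R' a b) t s) : Compat R t s ∨ Compat R' t s := by
  induction H with
  | base h => exact h.imp .base .base
  | lam _ ih => exact ih.imp .lam .lam
  | appL _ ih => exact ih.imp .appL .appL
  | appR _ ih => exact ih.imp .appR .appR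
  | pairL _ ih => exact ih.imp .pairL .pairL
  | pairR _ ih => exact ih.imp .pairR .pairR
  | proj1 _ ih => exact ih.imp .proj1 .proj1
  | proj2 _ ih => exact ih.imp .proj2 .proj2
  | inl _ ih => exact ih.imp .inl .inl
  | inr _ ih => exact ih.imp .inr .inr
  | case1 _ ih => exact ih.imp .case1 .case1
  | case2 _ ih => exact ih.imp .case2 .case2
  | case3 _ ih => exact ih.imp .case3 .case3
  | boxArg _ ih => exact ih.imp .boxArg .boxArg
  | boxBody _ ih => exact ih.imp .boxBody .boxBody
  | exf _ ih => exact ih.imp .exf .exf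

theorem step_iff {t s} : Step t s ↔ Compat Root t s := by
  constructor
  · rintro (h | h | h)
    · exact Compat.mono (fun _ _ h => Or.inl h) h
    · exact Compat.mono (fun _ _ h => Or.inr (Or.inl h)) h
    · exact Compat.mono (fun _ _ h => Or.inr (Or.inr h)) h
  · intro h
    rcases Compat.or h with h | h
    · exact Or.inl h
    · exact Or.inr (Compat.or h)

theorem step_eq : Step = Compat Root := by
  funext t s; exact propext step_iff

theorem subst_shift (t : Tm) (σ) :
    (t.rename (· + 1)).subst (liftSub 1 σ) = (t.subst σ).rename (· + 1) := by
  rw [subst_rename, rename_subst]; congr 1; 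

theorem subst_shift_lift (n) (t : Tm) (σ) :
    (t.rename (liftRen n (· + 1))).subst (liftSub n (liftSub 1 σ)) =
      (t.subst (liftSub n σ)).rename (liftRen n (· + 1)) := by
  rw [subst_rename, rename_subst, liftSub_liftRen, liftRen_liftSub]; rfl

theorem rename_shift (t : Tm) (f) :
    (t.rename (· + 1)).rename (liftRen 1 f) = (t.rename f).rename (· + 1) := by
  rw [rename_rename, rename_rename]; congr 1; 

theorem rename_shift_lift (n) (t : Tm) (f) :
    (t.rename (liftRen n (· + 1))).rename (liftRen n (liftRen 1 f)) =
      (t.rename (liftRen n f)).rename (liftRen n (· + 1)) := by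
  rw [rename_rename, rename_rename, liftRen_comp, liftRen_comp]; rfl

theorem Root.subst {t s} (h : Root t s) (σ) : Root (t.subst σ) (s.subst σ) := by
  rcases h with h | h | h
  · left
    cases h with
    | beta => rw [subst_subst1]; simp only [subst_app, subst_lam]; exact .beta
    | projPair1 => simp only [subst_proj1, subst_pair]; exact .projPair1
    | projPair2 => simp only [subst_proj2, subst_pair]; exact .projPair2
    | caseInl => rw [subst_subst1]; simp only [subst_case, subst_inl]; exact .caseInl
    | caseInr => rw [subst_subst1]; simp only [subst_case, subst_inr]; exact .caseInr
    | @boxBox l₁ l₂ us v r =>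
      have h := @DRed.boxBox (l₁.map (Tm.subst σ)) (l₂.map (Tm.subst σ)) (us.map (Tm.subst σ))
        (v.subst (liftSub us.length σ)) (r.subst (liftSub (l₁.length + 1 + l₂.length) σ))
      simp only [List.length_map] at h
      rw [← subst_boxSigma _ _ _ _ _ (by omega)] at h
      simp only [subst_box, List.map_append, List.map_cons, List.length_append, List.length_cons]
      convert h using 4 <;> omega
    | boxVar =>
      have : liftSub 1 σ 0 = .var 0 := rfl
      simp only [subst_box, List.map_cons, List.map_nil, subst_var, List.length_cons,
        List.length_nil, zero_add, this]
      exact .boxVar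
  · right; left
    cases h with
    | appCase => simp only [subst_app, subst_case, subst_shift]; exact .appCase
    | proj1Case => simp only [subst_proj1, subst_case]; exact .proj1Case
    | proj2Case => simp only [subst_proj2, subst_case]; exact .proj2Case
    | caseCase => simp only [subst_case, subst_shift_lift]; exact .caseCase
    | @boxCase l₁ l₂ t a b s =>
      have h := @PRed.boxCase (l₁.map (Tm.subst σ)) (l₂.map (Tm.subst σ)) (t.subst σ)
        (a.subst (liftSub 1 σ)) (b.subst (liftSub 1 σ))
        (s.subst (liftSub (l₁.length + 1 + l₂.length) σ))
      simp only [List.length_map, ← subst_shift_lift] at h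
      have e : ∀ l : List Tm, (l.map (Tm.subst σ)).map (Tm.rename (· + 1)) =
          (l.map (Tm.rename (· + 1))).map (Tm.subst (liftSub 1 σ)) := by
        intro l; simp only [List.map_map]; apply List.map_congr_left; intro x _
        simp [subst_shift]
      rw [e, e] at h
      simp only [subst_box, subst_case, List.map_append, List.map_cons, List.length_append,
        List.length_cons, List.length_map]
      have e2 : l₁.length + (l₂.length + 1) = l₁.length + 1 + l₂.length := by omega
      rw [e2]; exact h
    | exfCase => simp only [subst_exf, subst_case]; exact .exfCase
  · right; right
    cases h with
    | appExf => simp only [subst_app, subst_exf]; exact .appExf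
    | proj1Exf => simp only [subst_proj1, subst_exf]; exact .proj1Exf
    | proj2Exf => simp only [subst_proj2, subst_exf]; exact .proj2Exf
    | caseExf => simp only [subst_case, subst_exf]; exact .caseExf
    | exfExf => simp only [subst_exf]; exact .exfExf
    | boxExf =>
      simp only [subst_box, subst_exf, List.map_append, List.map_cons]; exact .boxExf

theorem Step.subst {t s} (h : Step t s) : ∀ σ, Step (t.subst σ) (s.subst σ) := by
  rw [step_iff] at h
  simp only [step_eq]
  induction h with
  | base h' => exact fun σ => .base (h'.subst σ)
  | lam _ ih => intro σ; simp only [subst_lam]; exact .lam (ih _)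
  | appL _ ih => intro σ; simp only [subst_app]; exact .appL (ih _)
  | appR _ ih => intro σ; simp only [subst_app]; exact .appR (ih _)
  | pairL _ ih => intro σ; simp only [subst_pair]; exact .pairL (ih _)
  | pairR _ ih => intro σ; simp only [subst_pair]; exact .pairR (ih _)
  | proj1 _ ih => intro σ; simp only [subst_proj1]; exact .proj1 (ih _)
  | proj2 _ ih => intro σ; simp only [subst_proj2]; exact .proj2 (ih _)
  | inl _ ih => intro σ; simp only [subst_inl]; exact .inl (ih _)
  | inr _ ih => intro σ; simp only [subst_inr]; exact .inr (ih _)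
  | case1 _ ih => intro σ; simp only [subst_case]; exact .case1 (ih _)
  | case2 _ ih => intro σ; simp only [subst_case]; exact .case2 (ih _)
  | case3 _ ih => intro σ; simp only [subst_case]; exact .case3 (ih _)
  | boxArg _ ih =>
    intro σ; simp only [subst_box, List.map_append, List.map_cons, List.length_append,
      List.length_cons]
    exact .boxArg (ih _)
  | boxBody _ ih => intro σ; simp only [subst_box]; exact .boxBody (ih _)
  | exf _ ih => intro σ; simp only [subst_exf]; exact .exf (ih _)

/-! inversion of renaming -/

theorem rename_eq_lam {t : Tm} {f u} (h : t.rename f = .lam u) :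
    ∃ u', t = .lam u' ∧ u = u'.rename (liftRen 1 f) := by
  cases t <;> simp at h; exact ⟨_, rfl, h.symm⟩
theorem rename_eq_app {t : Tm} {f u v} (h : t.rename f = .app u v) :
    ∃ u' v', t = .app u' v' ∧ u = u'.rename f ∧ v = v'.rename f := by
  cases t <;> simp at h; exact ⟨_, _, rfl, h.1.symm, h.2.symm⟩
theorem rename_eq_pair {t : Tm} {f u v} (h : t.rename f = .pair u v) :
    ∃ u' v', t = .pair u' v' ∧ u = u'.rename f ∧ v = v'.rename f := by
  cases t <;> simp at h; exact ⟨_, _, rfl, h.1.symm, h.2.symm⟩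
theorem rename_eq_proj1 {t : Tm} {f u} (h : t.rename f = .proj1 u) :
    ∃ u', t = .proj1 u' ∧ u = u'.rename f := by
  cases t <;> simp at h; exact ⟨_, rfl, h.symm⟩
theorem rename_eq_proj2 {t : Tm} {f u} (h : t.rename f = .proj2 u) :
    ∃ u', t = .proj2 u' ∧ u = u'.rename f := by
  cases t <;> simp at h; exact ⟨_, rfl, h.symm⟩
theorem rename_eq_inl {t : Tm} {f u} (h : t.rename f = .inl u) :
    ∃ u', t = .inl u' ∧ u = u'.rename f := by
  cases t <;> simp at h; exact ⟨_, rfl, h.symm⟩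
theorem rename_eq_inr {t : Tm} {f u} (h : t.rename f = .inr u) :
    ∃ u', t = .inr u' ∧ u = u'.rename f := by
  cases t <;> simp at h; exact ⟨_, rfl, h.symm⟩
theorem rename_eq_exf {t : Tm} {f u} (h : t.rename f = .exf u) :
    ∃ u', t = .exf u' ∧ u = u'.rename f := by
  cases t <;> simp at h; exact ⟨_, rfl, h.symm⟩
theorem rename_eq_case {t : Tm} {f u a b} (h : t.rename f = .case u a b) :
    ∃ u' a' b', t = .case u' a' b' ∧ u = u'.rename f ∧ a = a'.rename (liftRen 1 f) ∧
      b = b'.rename (liftRen 1 f) := by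
  cases t <;> simp at h; exact ⟨_, _, _, rfl, h.1.symm, h.2.1.symm, h.2.2.symm⟩
theorem rename_eq_box {t : Tm} {f us v} (h : t.rename f = .box us v) :
    ∃ us' v', t = .box us' v' ∧ us = us'.map (Tm.rename f) ∧
      v = v'.rename (liftRen us'.length f) := by
  cases t <;> simp at h; exact ⟨_, _, rfl, h.1.symm, h.2.symm⟩
theorem rename_eq_var {t : Tm} {f n} (h : t.rename f = .var n) :
    ∃ m, t = .var m ∧ n = f m := by
  cases t <;> simp at h; exact ⟨_, rfl, h.symm⟩
theorem rename_eq_boxSplit {t : Tm} {f l₁ x l₂ v} (h : t.rename f = .box (l₁ ++ x :: l₂) v) :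
    ∃ l₁' x' l₂' v', t = .box (l₁' ++ x' :: l₂') v' ∧ l₁ = l₁'.map (Tm.rename f) ∧
      x = x'.rename f ∧ l₂ = l₂'.map (Tm.rename f) ∧
      v = v'.rename (liftRen (l₁'.length + 1 + l₂'.length) f) := by
  obtain ⟨us, v', rfl, h1, rfl⟩ := rename_eq_box h
  obtain ⟨m1, m2, rfl, rfl, h2⟩ := List.map_eq_append_iff.1 h1.symm
  obtain ⟨y, m3, rfl, rfl, rfl⟩ := List.map_eq_cons_iff.1 h2
  refine ⟨m1, y, m3, v', rfl, rfl, rfl, rfl, ?_⟩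
  congr 2; simp; omega

theorem Root.reflect {t : Tm} {f s} (h : Root (t.rename f) s) :
    ∃ t', Root t t' ∧ s = t'.rename f := by
  generalize e : t.rename f = x at h
  rcases h with h | h | h
  · cases h with
    | beta =>
      obtain ⟨a, b, rfl, h1, rfl⟩ := rename_eq_app e
      obtain ⟨a, rfl, rfl⟩ := rename_eq_lam h1.symm
      exact ⟨_, .inl .beta, (rename_subst1 _ _ _).symm⟩
    | projPair1 =>
      obtain ⟨a, rfl, h1⟩ := rename_eq_proj1 e
      obtain ⟨a, b, rfl, rfl, rfl⟩ := rename_eq_pair h1.symm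
      exact ⟨_, .inl .projPair1, rfl⟩
    | projPair2 =>
      obtain ⟨a, rfl, h1⟩ := rename_eq_proj2 e
      obtain ⟨a, b, rfl, rfl, rfl⟩ := rename_eq_pair h1.symm
      exact ⟨_, .inl .projPair2, rfl⟩
    | caseInl =>
      obtain ⟨a, b, c, rfl, h1, rfl, rfl⟩ := rename_eq_case e
      obtain ⟨a, rfl, rfl⟩ := rename_eq_inl h1.symm
      exact ⟨_, .inl .caseInl, (rename_subst1 _ _ _).symm⟩
    | caseInr =>
      obtain ⟨a, b, c, rfl, h1, rfl, rfl⟩ := rename_eq_case e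
      obtain ⟨a, rfl, rfl⟩ := rename_eq_inr h1.symm
      exact ⟨_, .inl .caseInr, (rename_subst1 _ _ _).symm⟩
    | boxBox =>
      obtain ⟨l₁, x, l₂, r, rfl, rfl, h1, rfl, rfl⟩ := rename_eq_boxSplit e
      obtain ⟨us, v, rfl, rfl, rfl⟩ := rename_eq_box h1.symm
      refine ⟨_, .inl .boxBox, ?_⟩
      simp only [rename_box, List.map_append, List.length_map]
      rw [← rename_boxSigma _ _ _ _ _ (by omega)]
      congr 3; simp; omega
    | boxVar =>
      obtain ⟨us, v, rfl, h1, h2⟩ := rename_eq_box e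
      obtain ⟨y, m3, rfl, rfl, h3⟩ := List.map_eq_cons_iff.1 h1.symm
      obtain rfl := List.map_eq_nil_iff.1 h3
      obtain ⟨m, rfl, h4⟩ := rename_eq_var h2.symm
      have : m = 0 := by
        by_contra hm
        simp [liftRen, hm] at h4
      subst this
      exact ⟨_, .inl .boxVar, rfl⟩
  · cases h with
    | appCase =>
      obtain ⟨a, b, rfl, h1, rfl⟩ := rename_eq_app e
      obtain ⟨a, b, c, rfl, rfl, rfl, rfl⟩ := rename_eq_case h1.symm
      exact ⟨_, .inr (.inl .appCase), by simp only [rename_case, rename_app, rename_shift]⟩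
    | proj1Case =>
      obtain ⟨a, rfl, h1⟩ := rename_eq_proj1 e
      obtain ⟨a, b, c, rfl, rfl, rfl, rfl⟩ := rename_eq_case h1.symm
      exact ⟨_, .inr (.inl .proj1Case), by simp only [rename_case, rename_proj1]⟩
    | proj2Case =>
      obtain ⟨a, rfl, h1⟩ := rename_eq_proj2 e
      obtain ⟨a, b, c, rfl, rfl, rfl, rfl⟩ := rename_eq_case h1.symm
      exact ⟨_, .inr (.inl .proj2Case), by simp only [rename_case, rename_proj2]⟩
    | caseCase =>
      obtain ⟨a, b, c, rfl, h1, rfl, rfl⟩ := rename_eq_case e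
      obtain ⟨a, b, c, rfl, rfl, rfl, rfl⟩ := rename_eq_case h1.symm
      exact ⟨_, .inr (.inl .caseCase), by simp only [rename_case, rename_shift_lift]⟩
    | boxCase =>
      obtain ⟨l₁, x, l₂, r, rfl, rfl, h1, rfl, rfl⟩ := rename_eq_boxSplit e
      obtain ⟨a, b, c, rfl, rfl, rfl, rfl⟩ := rename_eq_case h1.symm
      refine ⟨_, .inr (.inl .boxCase), ?_⟩
      have e1 : ∀ l : List Tm, (l.map (Tm.rename f)).map (Tm.rename (· + 1)) =
          (l.map (Tm.rename (· + 1))).map (Tm.rename (liftRen 1 f)) := by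
        intro l; simp only [List.map_map]; apply List.map_congr_left; intro x _
        simp [rename_shift]
      have e2 : l₁.length + (l₂.length + 1) = l₁.length + 1 + l₂.length := by omega
      simp only [rename_case, rename_box, List.map_append, List.map_cons, List.length_map,
        List.length_append, List.length_cons, e1, e2, rename_shift_lift]
    | exfCase =>
      obtain ⟨a, rfl, h1⟩ := rename_eq_exf e
      obtain ⟨a, b, c, rfl, rfl, rfl, rfl⟩ := rename_eq_case h1.symm
      exact ⟨_, .inr (.inl .exfCase), by simp only [rename_case, rename_exf]⟩
  · cases h with
    | appExf =>
      obtain ⟨a, b, rfl, h1, rfl⟩ := rename_eq_app e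
      obtain ⟨a, rfl, rfl⟩ := rename_eq_exf h1.symm
      exact ⟨_, .inr (.inr .appExf), by simp⟩
    | proj1Exf =>
      obtain ⟨a, rfl, h1⟩ := rename_eq_proj1 e
      obtain ⟨a, rfl, rfl⟩ := rename_eq_exf h1.symm
      exact ⟨_, .inr (.inr .proj1Exf), by simp⟩
    | proj2Exf =>
      obtain ⟨a, rfl, h1⟩ := rename_eq_proj2 e
      obtain ⟨a, rfl, rfl⟩ := rename_eq_exf h1.symm
      exact ⟨_, .inr (.inr .proj2Exf), by simp⟩
    | caseExf =>
      obtain ⟨a, b, c, rfl, h1, rfl, rfl⟩ := rename_eq_case e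
      obtain ⟨a, rfl, rfl⟩ := rename_eq_exf h1.symm
      exact ⟨_, .inr (.inr .caseExf), by simp⟩
    | exfExf =>
      obtain ⟨a, rfl, h1⟩ := rename_eq_exf e
      obtain ⟨a, rfl, rfl⟩ := rename_eq_exf h1.symm
      exact ⟨_, .inr (.inr .exfExf), by simp⟩
    | boxExf =>
      obtain ⟨l₁, x, l₂, r, rfl, rfl, h1, rfl, rfl⟩ := rename_eq_boxSplit e
      obtain ⟨a, rfl, rfl⟩ := rename_eq_exf h1.symm
      exact ⟨_, .inr (.inr .boxExf), by simp⟩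

theorem Step.reflect {t : Tm} {f s} (h : Step (t.rename f) s) :
    ∃ t', Step t t' ∧ s = t'.rename f := by
  simp only [step_eq] at *
  generalize e : t.rename f = x at h
  induction h generalizing t f with
  | base h' => subst e; obtain ⟨t', h1, h2⟩ := h'.reflect; exact ⟨t', .base h1, h2⟩
  | lam _ ih =>
    obtain ⟨a, rfl, rfl⟩ := rename_eq_lam e
    obtain ⟨a', h, rfl⟩ := ih rfl
    exact ⟨_, .lam h, by simp⟩
  | appL _ ih =>
    obtain ⟨a, b, rfl, rfl, rfl⟩ := rename_eq_app e
    obtain ⟨a', h, rfl⟩ := ih rfl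
    exact ⟨_, .appL h, by simp⟩
  | appR _ ih =>
    obtain ⟨a, b, rfl, rfl, rfl⟩ := rename_eq_app e
    obtain ⟨a', h, rfl⟩ := ih rfl
    exact ⟨_, .appR h, by simp⟩
  | pairL _ ih =>
    obtain ⟨a, b, rfl, rfl, rfl⟩ := rename_eq_pair e
    obtain ⟨a', h, rfl⟩ := ih rfl
    exact ⟨_, .pairL h, by simp⟩
  | pairR _ ih =>
    obtain ⟨a, b, rfl, rfl, rfl⟩ := rename_eq_pair e
    obtain ⟨a', h, rfl⟩ := ih rfl
    exact ⟨_, .pairR h, by simp⟩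
  | proj1 _ ih =>
    obtain ⟨a, rfl, rfl⟩ := rename_eq_proj1 e
    obtain ⟨a', h, rfl⟩ := ih rfl
    exact ⟨_, .proj1 h, by simp⟩
  | proj2 _ ih =>
    obtain ⟨a, rfl, rfl⟩ := rename_eq_proj2 e
    obtain ⟨a', h, rfl⟩ := ih rfl
    exact ⟨_, .proj2 h, by simp⟩
  | inl _ ih =>
    obtain ⟨a, rfl, rfl⟩ := rename_eq_inl e
    obtain ⟨a', h, rfl⟩ := ih rfl
    exact ⟨_, .inl h, by simp⟩
  | inr _ ih =>
    obtain ⟨a, rfl, rfl⟩ := rename_eq_inr e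
    obtain ⟨a', h, rfl⟩ := ih rfl
    exact ⟨_, .inr h, by simp⟩
  | case1 _ ih =>
    obtain ⟨a, b, c, rfl, rfl, rfl, rfl⟩ := rename_eq_case e
    obtain ⟨a', h, rfl⟩ := ih rfl
    exact ⟨_, .case1 h, by simp⟩
  | case2 _ ih =>
    obtain ⟨a, b, c, rfl, rfl, rfl, rfl⟩ := rename_eq_case e
    obtain ⟨a', h, rfl⟩ := ih rfl
    exact ⟨_, .case2 h, by simp⟩
  | case3 _ ih =>
    obtain ⟨a, b, c, rfl, rfl, rfl, rfl⟩ := rename_eq_case e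
    obtain ⟨a', h, rfl⟩ := ih rfl
    exact ⟨_, .case3 h, by simp⟩
  | boxArg _ ih =>
    obtain ⟨l₁, x, l₂, r, rfl, rfl, rfl, rfl, rfl⟩ := rename_eq_boxSplit e
    obtain ⟨a', h, rfl⟩ := ih rfl
    refine ⟨_, .boxArg h, ?_⟩
    have e2 : l₁.length + (l₂.length + 1) = l₁.length + 1 + l₂.length := by omega
    simp [e2]
  | boxBody _ ih =>
    obtain ⟨us, v, rfl, rfl, rfl⟩ := rename_eq_box e
    obtain ⟨a', h, rfl⟩ := ih rfl
    exact ⟨_, .boxBody h, by simp⟩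
  | exf _ ih =>
    obtain ⟨a, rfl, rfl⟩ := rename_eq_exf e
    obtain ⟨a', h, rfl⟩ := ih rfl
    exact ⟨_, .exf h, by simp⟩


set_option linter.unusedSimpArgs false

/-! ### Hereditarily good terms -/

structure Spec where
  lam : Tm → Prop := fun _ => True
  pair : Tm → Tm → Prop := fun _ _ => True
  inl : Tm → Prop := fun _ => True
  inr : Tm → Prop := fun _ => True
  box : Tm → Prop := fun _ => True

def botSpec : Spec := {}
def sumSpec (X Y : Tm → Prop) : Spec := { inl := X, inr := Y }
def boxSpec (X : Tm → Prop) : Spec := { box := X }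

def Spec.holds (S : Spec) : Tm → Prop
  | .lam u => ∀ f, S.lam (u.rename (liftRen 1 f))
  | .pair a b => ∀ f, S.pair (a.rename f) (b.rename f)
  | .inl a => ∀ f, S.inl (a.rename f)
  | .inr a => ∀ f, S.inr (a.rename f)
  | _ => True

theorem Spec.holds_rename (S : Spec) {t : Tm} (h : S.holds t) (f) : S.holds (t.rename f) := by
  cases t <;> simp_all [Spec.holds, rename_rename, liftRen_comp]

structure GoodC (G : Spec → Tm → Prop) (S : Spec) (t : Tm) : Prop where
  val : S.holds t
  step : ∀ t', Step t t' → G S t'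
  case : ∀ u p q, t = .case u p q → ∃ X Y : Tm → Prop,
    (∀ n, X (.var n)) ∧ (∀ n, Y (.var n)) ∧ G (sumSpec X Y) u ∧
    (∀ f w, X w → G S (p.subst (msub [w] f))) ∧ (∀ f w, Y w → G S (q.subst (msub [w] f)))
  exf : ∀ u, t = .exf u → G botSpec u
  box : ∀ us v, t = .box us v → ∃ L : List ((Tm → Prop) × Tm), L.map Prod.snd = us ∧
    (∀ e ∈ L, (∀ n, e.1 (.var n)) ∧ G (boxSpec e.1) e.2) ∧
    ∀ vs f, List.Forall₂ (fun e v => e.1 v) L vs → S.box (v.subst (msub vs f))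

theorem GoodC.mono {G G' : Spec → Tm → Prop} (hG : ∀ S t, G S t → G' S t) {S t}
    (h : GoodC G S t) : GoodC G' S t where
  val := h.val
  step t' ht := hG _ _ (h.step t' ht)
  case u p q e := by
    obtain ⟨X, Y, h1, h2, h3, h4, h5⟩ := h.case u p q e
    exact ⟨X, Y, h1, h2, hG _ _ h3, fun f w hw => hG _ _ (h4 f w hw),
      fun f w hw => hG _ _ (h5 f w hw)⟩
  exf u e := hG _ _ (h.exf u e)
  box us v e := by
    obtain ⟨L, h1, h2, h3⟩ := h.box us v e
    exact ⟨L, h1, fun e he => ⟨(h2 e he).1, hG _ _ (h2 e he).2⟩, h3⟩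

def GoodO (o : Ordinal.{0}) (S : Spec) (t : Tm) : Prop :=
  GoodC (fun S t => ∃ o', ∃ _ : o' < o, GoodO o' S t) S t
termination_by o
decreasing_by assumption

def Good (S : Spec) (t : Tm) : Prop := ∃ o, GoodO o S t

theorem goodO_iff {o S t} :
    GoodO o S t ↔ GoodC (fun S t => ∃ o', o' < o ∧ GoodO o' S t) S t := by
  rw [GoodO]; simp only [exists_prop]

open Classical in
theorem exists_bound : ∃ Ω : Ordinal.{0}, ∀ S t, Good S t → ∃ o, o < Ω ∧ GoodO o S t := by
  let O : Spec × Tm → Ordinal.{0} := fun p => if h : Good p.1 p.2 then h.choose else 0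
  refine ⟨Order.succ (⨆ p, O p), fun S t h => ⟨O (S, t), ?_, ?_⟩⟩
  · exact Order.lt_succ_of_le (Ordinal.le_iSup O (S, t))
  · have : O (S, t) = h.choose := by simp [O, h]
    rw [this]; exact h.choose_spec

theorem good_iff {S t} : Good S t ↔ GoodC Good S t := by
  constructor
  · rintro ⟨o, h⟩
    rw [goodO_iff] at h
    exact h.mono fun S t ⟨o', _, h⟩ => ⟨o', h⟩
  · intro h
    obtain ⟨Ω, hΩ⟩ := exists_bound
    exact ⟨Ω, goodO_iff.2 (h.mono hΩ)⟩

theorem Good.step {S t t'} (h : Good S t) (hs : Step t t') : Good S t' :=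
  (good_iff.1 h).step _ hs

abbrev SN (t : Tm) : Prop := Acc (fun a b : Tm => Step b a) t

theorem GoodO.sn : ∀ {o S t}, GoodO o S t → SN t := by
  intro o
  induction o using WellFoundedLT.induction with
  | ind o ih =>
    intro S t h
    refine ⟨_, fun t' ht => ?_⟩
    obtain ⟨o', ho, h'⟩ := (goodO_iff.1 h).step t' ht
    exact ih o' ho h'

theorem Good.sn {S t} (h : Good S t) : SN t := h.choose_spec.sn

theorem rename_lift_msub1 (t w : Tm) (f g) :
    (t.rename (liftRen 1 g)).subst (msub [w] f) = t.subst (msub [w] (f ∘ g)) :=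
  rename_lift_msub _ _ _ _ _ rfl

theorem GoodO.rename : ∀ {o S t}, GoodO o S t → ∀ f, GoodO o S (t.rename f) := by
  intro o
  induction o using WellFoundedLT.induction with
  | ind o ih =>
    intro S t h f
    rw [goodO_iff] at h ⊢
    refine ⟨S.holds_rename h.val f, ?_, ?_, ?_, ?_⟩
    · intro t' ht
      obtain ⟨t'', h1, rfl⟩ := ht.reflect
      obtain ⟨o', ho, h'⟩ := h.step _ h1
      exact ⟨o', ho, ih o' ho h' f⟩
    · intro u p q e
      obtain ⟨u, p, q, rfl, rfl, rfl, rfl⟩ := rename_eq_case e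
      obtain ⟨X, Y, h1, h2, ⟨o', ho, h3⟩, h4, h5⟩ := h.case _ _ _ rfl
      refine ⟨X, Y, h1, h2, ⟨o', ho, ih o' ho h3 f⟩, fun g w hw => ?_, fun g w hw => ?_⟩
      · rw [rename_lift_msub1]; exact h4 _ _ hw
      · rw [rename_lift_msub1]; exact h5 _ _ hw
    · intro u e
      obtain ⟨u, rfl, rfl⟩ := rename_eq_exf e
      obtain ⟨o', ho, h'⟩ := h.exf _ rfl
      exact ⟨o', ho, ih o' ho h' f⟩
    · intro us v e
      obtain ⟨us, v, rfl, rfl, rfl⟩ := rename_eq_box e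
      obtain ⟨L, rfl, h2, h3⟩ := h.box _ _ rfl
      refine ⟨L.map (fun e => (e.1, e.2.rename f)), by simp, ?_, ?_⟩
      · intro e he
        obtain ⟨e0, he0, rfl⟩ := List.mem_map.1 he
        obtain ⟨hv, o', ho, h'⟩ := h2 e0 he0
        exact ⟨hv, o', ho, ih o' ho h' f⟩
      · intro vs g hvs
        rw [List.forall₂_map_left_iff] at hvs
        rw [rename_lift_msub _ _ _ _ _ (by simpa using hvs.length_eq.symm)]
        exact h3 _ _ hvs

theorem Good.rename {S t} (h : Good S t) (f) : Good S (t.rename f) :=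
  ⟨_, h.choose_spec.rename f⟩

theorem shift_msub (t w : Tm) (f) : (t.rename (· + 1)).subst (msub [w] f) = t.rename f := by
  rw [subst_rename, rename_eq_subst]; congr 1

theorem shift_lift_msub (n) (t w : Tm) (f) :
    (t.rename (liftRen n (· + 1))).subst (liftSub n (msub [w] f)) = t.rename (liftRen n f) := by
  rw [subst_rename, rename_eq_subst, liftSub_liftRen, ← liftSub_ren]; congr 1

theorem msub_one_id (t : Tm) : t.subst (msub [.var 0] (· + 1)) = t := by
  conv_rhs => rw [← subst_id t]
  congr 1; funext j; cases j <;> simp [msub]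

theorem msub_many_id (t : Tm) (n) :
    t.subst (msub ((List.range n).reverse.map Tm.var) (· + n)) = t := by
  conv_rhs => rw [← subst_id t]
  congr 1; funext j
  by_cases h : j < n
  · rw [msub_lt (by simpa using h)]; simp
  · rw [msub_ge (by simpa using h)]; simp; omega

theorem exf_case_lemma (o : Ordinal.{0}) :
    (∀ t S, GoodO o botSpec t → Good S (.exf t)) ∧
    (∀ t X Y S M N, GoodO o (sumSpec X Y) t → (∀ n, X (.var n)) → (∀ n, Y (.var n)) →
      (∀ f w, X w → Good S (M.subst (msub [w] f))) →
      (∀ f w, Y w → Good S (N.subst (msub [w] f))) → Good S (.case t M N)) := by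
  induction o using WellFoundedLT.induction with
  | ind o ih =>
    constructor
    · intro t S ht
      have ht' := goodO_iff.1 ht
      refine good_iff.2 ⟨trivial, ?_, by simp, ?_, by simp⟩
      · intro t' hs
        rw [step_iff] at hs
        cases hs with
        | base hs =>
          rcases hs with hs | hs | hs <;> cases hs
          · obtain ⟨X, Y, h1, h2, ⟨o', ho, h3⟩, h4, h5⟩ := ht'.case _ _ _ rfl
            refine (ih o' ho).2 _ X Y S _ _ h3 h1 h2 ?_ ?_
            · intro f w hw
              obtain ⟨o', ho, h'⟩ := h4 f w hw
              rw [subst_exf]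
              exact (ih o' ho).1 _ S h'
            · intro f w hw
              obtain ⟨o', ho, h'⟩ := h5 f w hw
              rw [subst_exf]
              exact (ih o' ho).1 _ S h'
          · obtain ⟨o', ho, h'⟩ := ht'.exf _ rfl
            exact (ih o' ho).1 _ S h'
        | exf hs =>
          obtain ⟨o', ho, h'⟩ := ht'.step _ (step_iff.2 hs)
          exact (ih o' ho).1 _ S h'
      · rintro u ⟨⟩; exact ⟨o, ht⟩
    · intro t X Y S M N ht hX hY hM hN
      have ht' := goodO_iff.1 ht
      have aM : SN M := by
        have := hM (· + 1) _ (hX 0)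
        rw [msub_one_id] at this; exact this.sn
      have aN : SN N := by
        have := hN (· + 1) _ (hY 0)
        rw [msub_one_id] at this; exact this.sn
      induction aM generalizing N with
      | intro M _ ihM =>
      induction aN with
      | intro N aN ihN =>
      refine good_iff.2 ⟨trivial, ?_, ?_, by simp, by simp⟩
      · intro t' hs
        rw [step_iff] at hs
        cases hs with
        | base hs =>
          rcases hs with hs | hs | hs <;> cases hs
          · rw [subst1_eq]; apply hM
            have := ht'.val id
            rwa [rename_id] at this
          · rw [subst1_eq]; apply hN
            have := ht'.val id
            rwa [rename_id] at this
          · obtain ⟨X', Y', h1, h2, ⟨o', ho, h3⟩, h4, h5⟩ := ht'.case _ _ _ rfl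
            refine (ih o' ho).2 _ X' Y' S _ _ h3 h1 h2 ?_ ?_
            · intro f w hw
              obtain ⟨o', ho, h'⟩ := h4 f w hw
              simp only [subst_case, shift_lift_msub]
              refine (ih o' ho).2 _ X Y S _ _ h' hX hY ?_ ?_
              · intro g z hz; rw [rename_lift_msub1]; exact hM _ _ hz
              · intro g z hz; rw [rename_lift_msub1]; exact hN _ _ hz
            · intro f w hw
              obtain ⟨o', ho, h'⟩ := h5 f w hw
              simp only [subst_case, shift_lift_msub]
              refine (ih o' ho).2 _ X Y S _ _ h' hX hY ?_ ?_
              · intro g z hz; rw [rename_lift_msub1]; exact hM _ _ hz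
              · intro g z hz; rw [rename_lift_msub1]; exact hN _ _ hz
          · obtain ⟨o', ho, h'⟩ := ht'.exf _ rfl
            exact (ih o' ho).1 _ S h'
        | case1 hs =>
          obtain ⟨o', ho, h'⟩ := ht'.step _ (step_iff.2 hs)
          exact (ih o' ho).2 _ X Y S _ _ h' hX hY hM hN
        | case2 hs =>
          exact ihM _ (step_iff.2 hs) _
            (fun f w hw => (hM f w hw).step ((step_iff.2 hs).subst _)) hN ⟨_, aN⟩
        | case3 hs =>
          exact ihN _ (step_iff.2 hs)
            (fun f w hw => (hN f w hw).step ((step_iff.2 hs).subst _))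
      · rintro u p q ⟨⟩
        exact ⟨X, Y, hX, hY, ⟨o, ht⟩, hM, hN⟩

theorem Good.exf {S t} (h : Good botSpec t) : Good S (.exf t) :=
  (exf_case_lemma h.choose).1 _ _ h.choose_spec

theorem Good.case {X Y S t M N} (h : Good (sumSpec X Y) t) (hX : ∀ n, X (.var n))
    (hY : ∀ n, Y (.var n)) (hM : ∀ f w, X w → Good S (M.subst (msub [w] f)))
    (hN : ∀ f w, Y w → Good S (N.subst (msub [w] f))) : Good S (.case t M N) :=
  (exf_case_lemma h.choose).2 _ _ _ _ _ _ h.choose_spec hX hY hM hN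

theorem good_var (S n) : Good S (.var n) := by
  refine good_iff.2 ⟨trivial, ?_, by simp, by simp, by simp⟩
  intro t' hs
  rw [step_iff] at hs
  cases hs with
  | base hs => rcases hs with hs | hs | hs <;> cases hs

/-! ### The other connectives -/

def arrSpec (A : Tm → Prop) (B : Spec) : Spec :=
  { lam := fun u => ∀ s, A s → Good B (u.subst (msub [s] id)) }

def prodSpec (A B : Spec) : Spec := { pair := fun a b => Good A a ∧ Good B b }

theorem good_lam {A : Tm → Prop} {B u} (hA : A (.var 0))
    (h : ∀ f s, A s → Good B (u.subst (msub [s] f))) : Good (arrSpec A B) (.lam u) := by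
  have a : SN u := by
    have := h (· + 1) _ hA
    rw [msub_one_id] at this; exact this.sn
  induction a with
  | intro u _ ih =>
    refine good_iff.2 ⟨?_, ?_, by simp, by simp, by simp⟩
    · intro f s hs
      rw [rename_lift_msub1]; exact h _ _ hs
    · intro t' hs
      rw [step_iff] at hs
      cases hs with
      | base hs => rcases hs with hs | hs | hs <;> cases hs
      | lam hs =>
        exact ih _ (step_iff.2 hs) fun f s h' => (h f s h').step ((step_iff.2 hs).subst _)

theorem good_pair {A B a b} (ha : Good A a) (hb : Good B b) :
    Good (prodSpec A B) (.pair a b) := by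
  have sa := ha.sn
  have sb := hb.sn
  induction sa generalizing b with
  | intro a _ iha =>
  induction sb with
  | intro b sb ihb =>
    refine good_iff.2 ⟨fun f => ⟨ha.rename f, hb.rename f⟩, ?_, by simp, by simp, by simp⟩
    intro t' hs
    rw [step_iff] at hs
    cases hs with
    | base hs => rcases hs with hs | hs | hs <;> cases hs
    | pairL hs => exact iha _ (step_iff.2 hs) (ha.step (step_iff.2 hs)) hb ⟨_, sb⟩
    | pairR hs => exact ihb _ (step_iff.2 hs) (hb.step (step_iff.2 hs))

theorem good_inl {A a} {Y} (ha : Good A a) : Good (sumSpec (Good A) Y) (.inl a) := by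
  have sa := ha.sn
  induction sa with
  | intro a _ iha =>
    refine good_iff.2 ⟨fun f => ha.rename f, ?_, by simp, by simp, by simp⟩
    intro t' hs
    rw [step_iff] at hs
    cases hs with
    | base hs => rcases hs with hs | hs | hs <;> cases hs
    | inl hs => exact iha _ (step_iff.2 hs) (ha.step (step_iff.2 hs))

theorem good_inr {A a} {Y} (ha : Good A a) : Good (sumSpec Y (Good A)) (.inr a) := by
  have sa := ha.sn
  induction sa with
  | intro a _ iha =>
    refine good_iff.2 ⟨fun f => ha.rename f, ?_, by simp, by simp, by simp⟩
    intro t' hs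
    rw [step_iff] at hs
    cases hs with
    | base hs => rcases hs with hs | hs | hs <;> cases hs
    | inr hs => exact iha _ (step_iff.2 hs) (ha.step (step_iff.2 hs))

theorem good_proj1 {A B t} (ht : Good (prodSpec A B) t) : Good A (.proj1 t) := by
  obtain ⟨o, ht⟩ := ht
  induction o using WellFoundedLT.induction generalizing t with
  | ind o ih =>
    have ht' := goodO_iff.1 ht
    refine good_iff.2 ⟨trivial, ?_, by simp, by simp, by simp⟩
    intro t' hs
    rw [step_iff] at hs
    cases hs with
    | base hs =>
      rcases hs with hs | hs | hs <;> cases hs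
      · have := (ht'.val id).1
        rwa [rename_id] at this
      · obtain ⟨X', Y', h1, h2, ⟨o', ho, h3⟩, h4, h5⟩ := ht'.case _ _ _ rfl
        refine Good.case ⟨_, h3⟩ h1 h2 ?_ ?_
        · intro f w hw
          obtain ⟨o', ho, h'⟩ := h4 f w hw
          rw [subst_proj1]
          exact ih o' ho h'
        · intro f w hw
          obtain ⟨o', ho, h'⟩ := h5 f w hw
          rw [subst_proj1]
          exact ih o' ho h'
      · obtain ⟨o', ho, h'⟩ := ht'.exf _ rfl
        exact Good.exf ⟨_, h'⟩
    | proj1 hs =>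
      obtain ⟨o', ho, h'⟩ := ht'.step _ (step_iff.2 hs)
      exact ih o' ho h'

theorem good_proj2 {A B t} (ht : Good (prodSpec A B) t) : Good B (.proj2 t) := by
  obtain ⟨o, ht⟩ := ht
  induction o using WellFoundedLT.induction generalizing t with
  | ind o ih =>
    have ht' := goodO_iff.1 ht
    refine good_iff.2 ⟨trivial, ?_, by simp, by simp, by simp⟩
    intro t' hs
    rw [step_iff] at hs
    cases hs with
    | base hs =>
      rcases hs with hs | hs | hs <;> cases hs
      · have := (ht'.val id).2
        rwa [rename_id] at this
      · obtain ⟨X', Y', h1, h2, ⟨o', ho, h3⟩, h4, h5⟩ := ht'.case _ _ _ rfl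
        refine Good.case ⟨_, h3⟩ h1 h2 ?_ ?_
        · intro f w hw
          obtain ⟨o', ho, h'⟩ := h4 f w hw
          rw [subst_proj2]
          exact ih o' ho h'
        · intro f w hw
          obtain ⟨o', ho, h'⟩ := h5 f w hw
          rw [subst_proj2]
          exact ih o' ho h'
      · obtain ⟨o', ho, h'⟩ := ht'.exf _ rfl
        exact Good.exf ⟨_, h'⟩
    | proj2 hs =>
      obtain ⟨o', ho, h'⟩ := ht'.step _ (step_iff.2 hs)
      exact ih o' ho h'

theorem good_app {A B t s} (ht : Good (arrSpec (Good A) B) t) (hs : Good A s) :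
    Good B (.app t s) := by
  obtain ⟨o, ht⟩ := ht
  induction o using WellFoundedLT.induction generalizing t s with
  | ind o ih =>
    have ht' := goodO_iff.1 ht
    have as := hs.sn
    induction as with
    | intro s _ ihs =>
    refine good_iff.2 ⟨trivial, ?_, by simp, by simp, by simp⟩
    intro t' hst
    rw [step_iff] at hst
    cases hst with
    | base hst =>
      rcases hst with hst | hst | hst <;> cases hst
      · have := ht'.val id _ hs
        rw [rename_lift_msub1] at this
        rw [subst1_eq]; exact this
      · obtain ⟨X', Y', h1, h2, ⟨o', ho, h3⟩, h4, h5⟩ := ht'.case _ _ _ rfl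
        refine Good.case ⟨_, h3⟩ h1 h2 ?_ ?_
        · intro f w hw
          obtain ⟨o', ho, h'⟩ := h4 f w hw
          rw [subst_app, shift_msub]
          exact ih o' ho (hs.rename f) h'
        · intro f w hw
          obtain ⟨o', ho, h'⟩ := h5 f w hw
          rw [subst_app, shift_msub]
          exact ih o' ho (hs.rename f) h'
      · obtain ⟨o', ho, h'⟩ := ht'.exf _ rfl
        exact Good.exf ⟨_, h'⟩
    | appL hst =>
      obtain ⟨o', ho, h'⟩ := ht'.step _ (step_iff.2 hst)
      exact ih o' ho hs h'
    | appR hst => exact ihs _ (step_iff.2 hst) (hs.step (step_iff.2 hst))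


set_option linter.unusedSimpArgs false

/-! ### The modal connective -/

theorem GoodO.box_mono {X Y : Tm → Prop} (hXY : ∀ t, X t → Y t) :
    ∀ {o t}, GoodO o (boxSpec X) t → GoodO o (boxSpec Y) t := by
  intro o
  induction o using WellFoundedLT.induction with
  | ind o ih =>
    intro t h
    rw [goodO_iff] at h ⊢
    refine ⟨?_, ?_, ?_, h.exf, ?_⟩
    · cases t <;> simp [Spec.holds, boxSpec]
    · intro t' ht
      obtain ⟨o', ho, h'⟩ := h.step _ ht
      exact ⟨o', ho, ih o' ho h'⟩
    · intro u p q e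
      obtain ⟨X', Y', h1, h2, h3, h4, h5⟩ := h.case _ _ _ e
      refine ⟨X', Y', h1, h2, h3, fun g w hw => ?_, fun g w hw => ?_⟩
      · obtain ⟨o', ho, h'⟩ := h4 g w hw
        exact ⟨o', ho, ih o' ho h'⟩
      · obtain ⟨o', ho, h'⟩ := h5 g w hw
        exact ⟨o', ho, ih o' ho h'⟩
    · intro us v e
      obtain ⟨L, h1, h2, h3⟩ := h.box _ _ e
      exact ⟨L, h1, h2, fun vs f hvs => hXY _ (h3 vs f hvs)⟩

structure Ent where
  o : Ordinal.{0}
  X : Tm → Prop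
  t : Tm

def Ent.ok (e : Ent) : Prop := (∀ n, e.X (.var n)) ∧ GoodO e.o (boxSpec e.X) e.t

theorem cut_lemma (l1 T l2 : List Ordinal.{0}) (o : Ordinal.{0}) (h : ∀ o' ∈ T, o' < o) :
    Relation.CutExpand (· < ·) (↑(l1 ++ T ++ l2) : Multiset Ordinal.{0}) ↑(l1 ++ o :: l2) := by
  refine ⟨↑T, o, by simpa using h, ?_⟩
  simp only [← Multiset.coe_add, ← Multiset.cons_coe, ← Multiset.singleton_add]
  abel

theorem map_split {α β} {f : α → β} {L : List α} {l₁ l₂ x} (h : L.map f = l₁ ++ x :: l₂) :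
    ∃ L₁ e L₂, L = L₁ ++ e :: L₂ ∧ L₁.map f = l₁ ∧ f e = x ∧ L₂.map f = l₂ := by
  obtain ⟨L₁, L', rfl, rfl, h'⟩ := List.map_eq_append_iff.1 h
  obtain ⟨e, L₂, rfl, rfl, rfl⟩ := List.map_eq_cons_iff.1 h'
  exact ⟨L₁, e, L₂, rfl, rfl, rfl, rfl⟩

theorem exists_ents {o : Ordinal.{0}} (L : List ((Tm → Prop) × Tm))
    (h : ∀ e ∈ L, (∀ n, e.1 (.var n)) ∧ ∃ o', o' < o ∧ GoodO o' (boxSpec e.1) e.2) :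
    ∃ E : List Ent, E.map (fun e => (e.X, e.t)) = L ∧ ∀ e ∈ E, e.ok ∧ e.o < o := by
  induction L with
  | nil => exact ⟨[], rfl, by simp⟩
  | cons e L ih =>
    obtain ⟨E, hE, hE'⟩ := ih fun e he => h e (List.mem_cons_of_mem _ he)
    obtain ⟨hv, o', ho, h'⟩ := h e List.mem_cons_self
    refine ⟨⟨o', e.1, e.2⟩ :: E, by simp [hE], ?_⟩
    intro a ha
    rcases List.mem_cons.1 ha with rfl | ha
    · exact ⟨⟨hv, h'⟩, ho⟩
    · exact hE' a ha

def Ent.ren (f : ℕ → ℕ) (e : Ent) : Ent := ⟨e.o, e.X, e.t.rename f⟩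

theorem Ent.ok.ren {e : Ent} (h : e.ok) (f) : (e.ren f).ok := ⟨h.1, h.2.rename f⟩

abbrev Args (L : List Ent) (vs : List Tm) : Prop := List.Forall₂ (fun e v => e.X v) L vs

theorem args_ren {L vs} {f} : Args (L.map (Ent.ren f)) vs ↔ Args L vs := by
  unfold Args; rw [List.forall₂_map_left_iff]; rfl

theorem args_cons {e L vs} :
    Args (e :: L) vs ↔ ∃ v v2, vs = v :: v2 ∧ e.X v ∧ Args L v2 := by
  unfold Args; rw [List.forall₂_cons_left_iff]; tauto

theorem args_append {L1 L2 vs} :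
    Args (L1 ++ L2) vs ↔ ∃ v1 v2, vs = v1 ++ v2 ∧ Args L1 v1 ∧ Args L2 v2 := by
  constructor
  · intro h
    induction L1 generalizing vs with
    | nil => exact ⟨[], vs, rfl, .nil, h⟩
    | cons e L1 ih =>
      obtain ⟨v, v2, rfl, hv, h2⟩ := args_cons.1 h
      obtain ⟨v3, v4, rfl, h3, h4⟩ := ih h2
      exact ⟨v :: v3, v4, rfl, .cons hv h3, h4⟩
  · rintro ⟨v1, v2, rfl, h1, h2⟩; exact List.rel_append h1 h2

theorem args_vars {L : List Ent} (h : ∀ e ∈ L, e.ok) (ns : List ℕ) (hl : ns.length = L.length) :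
    Args L (ns.map Tm.var) := by
  induction L generalizing ns with
  | nil => cases ns <;> simp_all [Args]
  | cons e L ih =>
    cases ns with
    | nil => simp at hl
    | cons n ns =>
      simp only [List.map_cons]
      exact .cons ((h e List.mem_cons_self).1 n)
        (ih (fun e he => h e (List.mem_cons_of_mem _ he)) ns (by simpa using hl))

theorem case_branch {L1 L2 : List Ent} {a r w : Tm} {f n} (hn : n = L1.length + 1 + L2.length) :
    (Tm.box ((L1.map Ent.t).map (Tm.rename (· + 1)) ++ a :: (L2.map Ent.t).map (Tm.rename (· + 1)))
      (r.rename (liftRen n (· + 1)))).subst (msub [w] f) =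
    .box (L1.map (Ent.t ∘ Ent.ren f) ++ a.subst (msub [w] f) :: L2.map (Ent.t ∘ Ent.ren f))
      (r.rename (liftRen n f)) := by
  subst hn
  rw [subst_box]
  congr 1
  · have : Tm.subst (msub [w] f) ∘ Tm.rename (· + 1) ∘ Ent.t = Ent.t ∘ Ent.ren f := by
      funext e; simp only [Function.comp, shift_msub]; rfl
    simp only [List.map_append, List.map_cons, List.map_map, this]
  · rw [← shift_lift_msub _ r w f]
    congr 2
    simp; omega

theorem box_lemma {Y : Tm → Prop} (hY : ∀ t t', Y t → Step t t' → Y t') (hsn : ∀ t, Y t → SN t)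
    (m : Multiset Ordinal.{0}) :
    ∀ L : List Ent, (↑(L.map Ent.o) : Multiset Ordinal.{0}) = m → (∀ e ∈ L, e.ok) →
      ∀ r, (∀ vs f, Args L vs → Y (r.subst (msub vs f))) →
        Good (boxSpec Y) (.box (L.map Ent.t) r) := by
  have wf : WellFounded (Relation.CutExpand (α := Ordinal.{0}) (· < ·)) :=
    wellFounded_lt.cutExpand
  induction m using wf.induction with
  | _ m ih =>
  intro L hm hL r hr
  subst hm
  have ar : SN r := by
    have := hr _ (· + L.length) (args_vars hL (List.range L.length).reverse (by simp))
    rw [msub_many_id] at this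
    exact hsn _ this
  have key : ∀ L1 e L2 T, L = L1 ++ e :: L2 → (∀ e' ∈ T, e'.ok ∧ e'.o < e.o) → ∀ f g r',
      (∀ vs h, Args (L1.map (Ent.ren f) ++ T ++ L2.map (Ent.ren g)) vs → Y (r'.subst (msub vs h))) →
      Good (boxSpec Y) (.box ((L1.map (Ent.ren f) ++ T ++ L2.map (Ent.ren g)).map Ent.t) r') := by
    intro L1 e L2 T hLe hT f g r' hr'
    refine ih _ ?_ _ rfl ?_ r' hr'
    · have := cut_lemma (L1.map Ent.o) (T.map Ent.o) (L2.map Ent.o) e.o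
        (by intro o' ho; obtain ⟨e', he', rfl⟩ := List.mem_map.1 ho; exact (hT e' he').2)
      have ren : ∀ f, Ent.o ∘ Ent.ren f = Ent.o := fun f => rfl
      simpa [hLe, ren] using this
    · subst hLe
      intro a ha
      simp only [List.mem_append, List.mem_map] at ha
      rcases ha with (⟨b, hb, rfl⟩ | ha) | ⟨b, hb, rfl⟩
      · exact (hL b (by simp [hb])).ren f
      · exact (hT a ha).1
      · exact (hL b (by simp [hb])).ren g
  have key0 : ∀ L1 e L2 T, L = L1 ++ e :: L2 → (∀ e' ∈ T, e'.ok ∧ e'.o < e.o) → ∀ r',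
      (∀ vs h, Args (L1 ++ T ++ L2) vs → Y (r'.subst (msub vs h))) →
      Good (boxSpec Y) (.box ((L1 ++ T ++ L2).map Ent.t) r') := by
    intro L1 e L2 T hLe hT r' hr'
    have rid : Ent.ren id = id := by
      funext e; simp [Ent.ren, rename_id]
    have := key L1 e L2 T hLe hT id id r'
    simp only [rid, List.map_id] at this
    exact this hr'
  clear ih
  induction ar with
  | intro r _ ihr =>
  refine good_iff.2 ⟨trivial, ?_, by simp, by simp, ?_⟩
  · intro x hs
    rw [step_iff] at hs
    generalize hts : L.map Ent.t = ts at hs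
    cases hs with
    | base hs =>
      rcases hs with hs | hs | hs <;> cases hs
      · -- boxBox
        obtain ⟨L1, e, L2, rfl, rfl, he, rfl⟩ := map_split hts
        have heo := hL e (by simp)
        obtain ⟨P, rfl, hP, hP'⟩ := (goodO_iff.1 heo.2).box _ _ he
        obtain ⟨T, rfl, hT⟩ := exists_ents P hP
        have := key0 L1 e L2 T rfl hT
        simp only [List.map_append, List.map_map, List.length_map] at this ⊢
        refine this _ ?_
        intro vs f hvs
        obtain ⟨v', v2, rfl, h', h2⟩ := args_append.1 hvs
        obtain ⟨v1, w, rfl, h1, hw⟩ := args_append.1 h'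
        rw [h1.length_eq, h2.length_eq, hw.length_eq, boxSigma_msub]
        apply hr
        refine args_append.2 ⟨_, _, rfl, h1, args_cons.2 ⟨_, _, rfl, ?_, h2⟩⟩
        exact hP' w f (by rw [List.forall₂_map_left_iff]; exact hw)
      · -- boxVar
        obtain ⟨e, L2, rfl, rfl, h2⟩ := List.map_eq_cons_iff.1 hts
        simp only [List.map_eq_nil_iff] at h2
        subst h2
        refine ⟨e.o, (hL e (by simp)).2.box_mono fun v hv => ?_⟩
        have := hr [v] id (.cons hv .nil)
        rwa [subst_var, msub_lt (by simp)] at this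
      · -- boxCase
        obtain ⟨L1, e, L2, rfl, rfl, he, rfl⟩ := map_split hts
        have heo := hL e (by simp)
        obtain ⟨X', Y', h1, h2, ⟨o', ho, h3⟩, h4, h5⟩ := (goodO_iff.1 heo.2).case _ _ _ he
        have fin : ∀ f p, (∃ o', o' < e.o ∧ GoodO o' (boxSpec e.X) p) →
            Good (boxSpec Y) (.box (L1.map (Ent.t ∘ Ent.ren f) ++ p :: L2.map (Ent.t ∘ Ent.ren f))
              (r.rename (liftRen (L1.length + 1 + L2.length) f))) := by
          rintro f p ⟨o', ho, hp⟩
          have := key L1 e L2 [⟨o', e.X, p⟩] rfl (by simp [Ent.ok, ho, hp, heo.1]) f f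
            (r.rename (liftRen (L1.length + 1 + L2.length) f))
          simp only [List.map_append, List.map_map, List.map_cons, List.map_nil,
            List.append_assoc, List.singleton_append] at this
          refine this ?_
          intro vs g hvs
          have hvs' : Args (L1 ++ e :: L2) vs := by
            obtain ⟨v1, v', rfl, k1, k'⟩ := args_append.1 hvs
            obtain ⟨v, v2, rfl, k, k2⟩ := args_cons.1 k'
            exact args_append.2 ⟨_, _, rfl, args_ren.1 k1, args_cons.2 ⟨_, _, rfl, k, args_ren.1 k2⟩⟩
          rw [rename_lift_msub _ _ _ _ _ (by have := hvs'.length_eq; simp at this; omega)]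
          exact hr _ _ hvs'
        refine Good.case ⟨o', h3⟩ h1 h2 ?_ ?_
        · intro f w hw
          rw [case_branch (by simp)]
          simp only [List.length_map]
          exact fin f _ (h4 f w hw)
        · intro f w hw
          rw [case_branch (by simp)]
          simp only [List.length_map]
          exact fin f _ (h5 f w hw)
      · -- boxExf
        obtain ⟨L1, e, L2, rfl, rfl, he, rfl⟩ := map_split hts
        obtain ⟨o', ho, h'⟩ := (goodO_iff.1 (hL e (by simp)).2).exf _ he
        exact Good.exf ⟨_, h'⟩
    | boxArg hs =>
      obtain ⟨L1, e, L2, rfl, rfl, rfl, rfl⟩ := map_split hts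
      have heo := hL e (by simp)
      obtain ⟨o', ho, h'⟩ := (goodO_iff.1 heo.2).step _ (step_iff.2 hs)
      have := key0 L1 e L2 [⟨o', e.X, _⟩] rfl
        (by rintro e' he'; cases List.mem_singleton.1 he'; exact ⟨⟨heo.1, h'⟩, ho⟩) r
      simp only [List.map_append, List.map_map, List.map_cons, List.map_nil,
            List.append_assoc, List.singleton_append] at this
      refine this ?_
      intro vs g hvs
      apply hr
      obtain ⟨v1, v', rfl, k1, k'⟩ := args_append.1 hvs
      obtain ⟨v, v2, rfl, k, k2⟩ := args_cons.1 k'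
      exact args_append.2 ⟨_, _, rfl, k1, args_cons.2 ⟨_, _, rfl, k, k2⟩⟩
    | boxBody hs =>
      subst hts
      exact ihr _ (step_iff.2 hs) fun vs f hvs => hY _ _ (hr vs f hvs) ((step_iff.2 hs).subst _)
  · rintro us v ⟨⟩
    refine ⟨L.map fun e => (e.X, e.t), by simp, ?_, ?_⟩
    · intro e he
      obtain ⟨e0, he0, rfl⟩ := List.mem_map.1 he
      exact ⟨(hL e0 he0).1, _, (hL e0 he0).2⟩
    · intro vs f hvs
      rw [List.forall₂_map_left_iff] at hvs
      exact hr vs f hvs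

theorem good_box {B : Spec} (L : List ((Tm → Prop) × Tm))
    (h : ∀ e ∈ L, (∀ n, e.1 (.var n)) ∧ Good (boxSpec e.1) e.2) (r : Tm)
    (hr : ∀ vs f, List.Forall₂ (fun e v => e.1 v) L vs → Good B (r.subst (msub vs f))) :
    Good (boxSpec (Good B)) (.box (L.map Prod.snd) r) := by
  obtain ⟨Ω, hΩ⟩ := exists_bound
  obtain ⟨E, rfl, hE⟩ := exists_ents L fun e he => ⟨(h e he).1, hΩ _ _ (h e he).2⟩
  have := box_lemma (Y := Good B) (fun t t' h hs => h.step hs) (fun t h => h.sn) _ E rfl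
    (fun e he => (hE e he).1) r
  simp only [List.map_map]
  refine this fun vs f hvs => hr vs f ?_
  rwa [List.forall₂_map_left_iff]

/-! ### The fundamental lemma -/

def specOf : Ty → Spec
  | .atom _ => botSpec
  | .bot => botSpec
  | .arr A B => arrSpec (Good (specOf A)) (specOf B)
  | .prod A B => prodSpec (specOf A) (specOf B)
  | .sum A B => sumSpec (Good (specOf A)) (Good (specOf B))
  | .box A => boxSpec (Good (specOf A))

abbrev Red (A : Ty) : Tm → Prop := Good (specOf A)

abbrev RedS (Γ : List Ty) (σ : ℕ → Tm) : Prop := ∀ n A, Γ[n]? = some A → Red A (σ n)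

theorem redS_gsub {Γ σ} (h : RedS Γ σ) {As vs} (hv : List.Forall₂ Red As vs) (f) :
    RedS (As.reverse ++ Γ) (gsub vs (Tm.rename f ∘ σ)) := by
  intro n A hA
  have hl := hv.length_eq
  by_cases hn : n < vs.length
  · have hn' : n < As.length := by omega
    rw [List.getElem?_append_left (by simpa using hn'), List.getElem?_reverse hn',
      List.getElem?_eq_getElem (by omega)] at hA
    simp only [gsub, hn, dif_pos, List.getElem_reverse]
    cases hA
    have := hv.get (i := As.length - 1 - n) (by omega) (by omega)
    simpa [hl] using this
  · rw [List.getElem?_append_right (by simp; omega)] at hA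
    simp only [gsub, hn, dif_neg, not_false_iff, Function.comp]
    simp only [List.length_reverse, hl] at hA
    exact (h _ _ hA).rename f

theorem subst_lift_msub1 (t w : Tm) (f σ) :
    (t.subst (liftSub 1 σ)).subst (msub [w] f) = t.subst (gsub [w] (Tm.rename f ∘ σ)) :=
  subst_lift_msub _ _ _ _ _ rfl

theorem fundamental {Γ t C} (h : Typing Γ t C) : ∀ σ, RedS Γ σ → Red C (t.subst σ) := by
  induction h with
  | var h => intro σ hσ; rw [subst_var]; exact hσ _ _ h
  | @lam Γ t A B _ ih =>
    intro σ hσ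
    rw [subst_lam]
    refine good_lam (good_var _ _) fun f s hs => ?_
    rw [subst_lift_msub1]
    exact ih _ (redS_gsub hσ (As := [A]) (.cons hs .nil) f)
  | app _ _ ih1 ih2 => intro σ hσ; rw [subst_app]; exact good_app (ih1 σ hσ) (ih2 σ hσ)
  | pair _ _ ih1 ih2 => intro σ hσ; rw [subst_pair]; exact good_pair (ih1 σ hσ) (ih2 σ hσ)
  | proj1 _ ih => intro σ hσ; rw [subst_proj1]; exact good_proj1 (ih σ hσ)
  | proj2 _ ih => intro σ hσ; rw [subst_proj2]; exact good_proj2 (ih σ hσ)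
  | inl _ ih => intro σ hσ; rw [subst_inl]; exact good_inl (ih σ hσ)
  | inr _ ih => intro σ hσ; rw [subst_inr]; exact good_inr (ih σ hσ)
  | @case Γ t a b A B C _ _ _ ih1 ih2 ih3 =>
    intro σ hσ
    rw [subst_case]
    refine Good.case (ih1 σ hσ) (good_var _) (good_var _) (fun f s hs => ?_) (fun f s hs => ?_)
    · rw [subst_lift_msub1]
      exact ih2 _ (redS_gsub hσ (As := [A]) (.cons hs .nil) f)
    · rw [subst_lift_msub1]
      exact ih3 _ (redS_gsub hσ (As := [B]) (.cons hs .nil) f)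
  | @box Γ ts s As B hl _ _ ih1 ih2 =>
    intro σ hσ
    rw [subst_box]
    have := good_box (B := specOf B) ((List.zip ts As).map fun p => (Red p.2, p.1.subst σ)) ?_
      (s.subst (liftSub ts.length σ)) ?_
    · have e : ((List.zip ts As).map fun p => (Red p.2, p.1.subst σ)).map Prod.snd
          = ts.map (Tm.subst σ) := by
        rw [List.map_map]
        conv_rhs => rw [← List.map_fst_zip (l₁ := ts) (l₂ := As) hl.le, List.map_map]
        rfl
      rw [e] at this
      exact this
    · intro e he
      obtain ⟨p, hp, rfl⟩ := List.mem_map.1 he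
      exact ⟨good_var _, ih1 p hp σ hσ⟩
    · intro vs f hvs
      rw [List.forall₂_map_left_iff] at hvs
      have hvs' : List.Forall₂ Red As vs := by
        conv_lhs => rw [← List.map_snd_zip (l₁ := ts) (l₂ := As) hl.ge]
        rw [List.forall₂_map_left_iff]
        exact hvs
      rw [subst_lift_msub _ _ _ _ _ (by rw [hl, hvs'.length_eq])]
      exact ih2 _ (redS_gsub hσ hvs' f)
  | exf _ ih => intro σ hσ; rw [subst_exf]; exact Good.exf (ih σ hσ)

theorem typing_sn {Γ t A} (h : Typing Γ t A) : SN t := by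
  have := fundamental h Tm.var fun n A _ => good_var _ _
  rw [subst_id] at this
  exact this.sn

/-- **Full normalization for `IEL⁻`**: the reduction relation on well-typed
`λ^{□→∧∨⊥}`-terms given by the union of detour-, permutation- and `⊥`-conversions is
strongly normalizing: every term typable in some context is accessible for the converse
of the reduction relation, i.e. there is no infinite reduction sequence starting from a
well-typed term. -/
theorem full_normalization :
    ∀ t : Tm, (∃ Γ A, Typing Γ t A) → Acc (fun a b : Tm => Step b a) t := by
  rintro t ⟨Γ, A, h⟩
  exact typing_sn h

end IEL
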